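/- arXiv:1908.08911 — 11 statements merged into one kernel-verified Lean document; each statement's English description precedes it below -/
import Mathlib

section
/- Let G = (V,E) be a graph that has a vertex cover C of size k. Then for every linear order ≺ of V there exists a page assignment σ : E → {1,…,k} such that (≺, σ) is a k-page book embedding of G. -/
/-- If `G` has a vertex cover `C` of size `k`, then for every linear
(strict total) order `lt` on the vertices there is a page assignment
`σ : E → Fin k` such that `(lt, σ)` is a `k`-page book embedding of `G`, i.e.
no two edges `a b` and `c d` on the same page cross (`a ≺ c ≺ b ≺ d`). -/
theorem vertex_cover_book_embedding_any_order
    {V : Type*} (G : SimpleGraph V) (k : ℕ) (C : Finset V)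
    (hcov : ∀ ⦃a b : V⦄, G.Adj a b → a ∈ C ∨ b ∈ C)
    (hcard : C.card = k) :
    ∀ (lt : V → V → Prop), IsStrictTotalOrder V lt →
      ∃ σ : G.edgeSet → Fin k,
        ∀ (a b c d : V) (h1 : G.Adj a b) (h2 : G.Adj c d),
          σ ⟨s(a, b), h1⟩ = σ ⟨s(c, d), h2⟩ →
          ¬(lt a c ∧ lt c b ∧ lt b d) := by
  intro lt hlt
  have endpoint_in_cover : ∀ e : G.edgeSet, ∃ v ∈ C, v ∈ e.1 := by
    rintro ⟨e, he⟩
    induction e using Sym2.ind with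
    | _ a b =>
      rcases hcov he with h | h
      · exact ⟨a, h, Sym2.mem_mk_left a b⟩
      · exact ⟨b, h, Sym2.mem_mk_right a b⟩
  choose f hfC hfe using endpoint_in_cover
  refine ⟨fun e => C.equivFinOfCardEq hcard ⟨f e, hfC e⟩, ?_⟩
  rintro a b c d h1 h2 hσ ⟨hac, hcb, hbd⟩
  have hf : f ⟨s(a, b), h1⟩ = f ⟨s(c, d), h2⟩ :=
    congrArg Subtype.val ((C.equivFinOfCardEq hcard).injective hσ)
  have hab := Sym2.mem_iff.mp (hfe ⟨s(a, b), h1⟩)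
  have hcd := Sym2.mem_iff.mp (hfe ⟨s(c, d), h2⟩)
  rw [hf] at hab
  have ne_of_lt {x y : V} (h : lt x y) : x ≠ y := ne_of_irrefl h
  rcases hab with ha | hb <;> rcases hcd with hc | hd
  · exact ne_of_lt hac (ha.symm.trans hc)
  · exact ne_of_lt (_root_.trans (_root_.trans hac hcb) hbd) (ha.symm.trans hd)
  · exact ne_of_lt hcb (hc.symm.trans hb)
  · exact ne_of_lt hbd (hb.symm.trans hd)
end

section
/- Let G = (V,E) be a graph and ≺ a linear order of V such that (G,≺) has pathwidth k. Then there exists a page assignment σ : E → {1,…,k} such that (≺, σ) is a k-page book embedding of G. -/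
/-- Greedy colouring along a well-founded relation: every vertex `c` gets a colour at most the
number of its predecessors in `B c`, different from all of their colours. -/
theorem exists_greedy_coloring {α : Type*} {r : α → α → Prop} (hr : WellFounded r)
    (B : α → Finset α) (hB : ∀ c, ∀ b ∈ B c, r b c) :
    ∃ f : α → ℕ, ∀ c, f c ≤ (B c).card ∧ ∀ b ∈ B c, f b ≠ f c := by
  have avoid : ∀ s : Finset ℕ, ∃ x ≤ s.card, x ∉ s := fun s => by
    obtain ⟨x, hx, hxs⟩ := Finset.exists_mem_notMem_of_card_lt_card
      (s := s) (t := Finset.range (s.card + 1)) (by simp)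
    exact ⟨x, Nat.lt_succ_iff.mp (Finset.mem_range.mp hx), hxs⟩
  choose m hm hms using avoid
  let F : (c : α) → ((b : α) → r b c → ℕ) → ℕ := fun c g =>
    m ((B c).attach.image fun b => g b.1 (hB c b.1 b.2))
  have hf : ∀ c, hr.fix F c = m ((B c).attach.image fun b => hr.fix F b.1) :=
    fun c => hr.fix_eq F c
  refine ⟨hr.fix F, fun c => ⟨?_, fun b hb h => ?_⟩⟩
  · rw [hf c]
    exact (hm _).trans (Finset.card_image_le.trans_eq (Finset.card_attach ..))
  · refine hms ((B c).attach.image fun b => hr.fix F b.1) ?_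
    rw [← hf c, ← h]
    exact Finset.mem_image.mpr ⟨⟨b, hb⟩, Finset.mem_attach _ _, rfl⟩

/-- Vertices are `v_0 < v_1 < … < v_{n-1}` (modelled as `Fin n`
with its natural order, which plays the role of the fixed linear order `≺`).
The guard set of `v i` is `{j | j < i ∧ ∃ q ≥ i, v j ~ v q}` and the pathwidth
of `(G, ≺)` is the maximum cardinality of a guard set.  If `(G, ≺)` has
pathwidth `k`, then there is a page assignment `σ : E → Fin k` making
`(≺, σ)` a `k`-page book embedding of `G` (no two same-page edges cross). -/
theorem pathwidth_book_embedding
    {n k : ℕ} (G : SimpleGraph (Fin n))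
    (hpw : Finset.univ.sup
        (fun i : Fin n =>
          ({j : Fin n | j < i ∧ ∃ q : Fin n, i ≤ q ∧ G.Adj j q}).ncard) = k) :
    ∃ σ : G.edgeSet → Fin k,
      ∀ (a b c d : Fin n) (h1 : G.Adj a b) (h2 : G.Adj c d),
        σ ⟨s(a, b), h1⟩ = σ ⟨s(c, d), h2⟩ →
        ¬(a < c ∧ c < b ∧ b < d) := by
  classical
  let B : Fin n → Finset (Fin n) := fun c => {a | a < c ∧ ∃ q, c < q ∧ G.Adj a q}
  obtain ⟨f, hf⟩ := exists_greedy_coloring (wellFounded_lt (α := Fin n)) B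
    (fun c b hb => by simp only [B, Finset.mem_filter] at hb; exact hb.2.1)
  have hBk : ∀ c d, c < d → G.Adj c d → (B c).card < k := by
    intro c d hcd h
    let i : Fin n := ⟨c + 1, by omega⟩
    have hi : ∀ q, c < q → i ≤ q := fun q hq => Nat.succ_le_of_lt hq
    have hci : c < i := Nat.lt_succ_self c.1
    have hc : c ∉ B c := by simp [B]
    have hsub : ((insert c (B c) : Finset (Fin n)) : Set (Fin n)) ⊆
        {j : Fin n | j < i ∧ ∃ q : Fin n, i ≤ q ∧ G.Adj j q} := by
      intro a ha
      simp only [B, Finset.coe_insert, Set.mem_insert_iff, Finset.mem_coe,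
        Finset.mem_filter] at ha
      obtain rfl | ⟨-, hac, q, hq, haq⟩ := ha
      · exact ⟨hci, d, hi d hcd, h⟩
      · exact ⟨hac.trans hci, q, hi q hq, haq⟩
    have hle := Set.ncard_le_ncard hsub (Set.toFinite _)
    rw [Set.ncard_coe_finset, Finset.card_insert_of_notMem hc] at hle
    rw [← hpw]
    exact Nat.lt_of_succ_le (hle.trans (Finset.le_sup (f := fun i : Fin n =>
      ({j : Fin n | j < i ∧ ∃ q : Fin n, i ≤ q ∧ G.Adj j q}).ncard) (Finset.mem_univ i)))
  have hfk : ∀ e : G.edgeSet, f e.1.inf < k := by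
    rintro ⟨e, he⟩
    induction e with | _ a b
    have hab : G.Adj a b := he
    rw [Sym2.inf_mk]
    rcases lt_or_gt_of_ne hab.ne with h | h
    · rw [inf_eq_left.mpr h.le]
      exact (hf a).1.trans_lt (hBk a b h hab)
    · rw [inf_eq_right.mpr h.le]
      exact (hf b).1.trans_lt (hBk b a h hab.symm)
  refine ⟨fun e => ⟨f e.1.inf, hfk e⟩, ?_⟩
  rintro a b c d h1 h2 h ⟨hac, hcb, hbd⟩
  have h' : f a = f c := by
    simpa [(hac.trans hcb).le, (hcb.trans hbd).le] using h
  exact (hf c).2 a (by simpa [B] using ⟨hac, b, hcb, h1⟩) h'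
end

section
/- Fix a graph G = (V,E) with vertices indexed v_1 ≺ … ≺ v_n, an index i ∈ [n], a valid partial page assignment α : E_i → {1,…,k}, an index a ≤ i, and a page p. If no edge v_c v_d ∈ E_i with c < a satisfies α(v_c v_d) = p, then every vertex v_x with x < a is α-visible to v_a on page p. Otherwise, letting v_c be the (α,i,p)-important guard of v_a (the vertex with the largest index c < a such that some edge v_c v_d ∈ E_i has α(v_c v_d) = p), a vertex v_x with x < a is α-visible to v_a on page p if and only if x ≥ c. -/
/-- The set `E_i` of edges (written as ordered pairs, left endpoint first)
whose right endpoint lies strictly to the right of `v i`. -/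
def Ei {n : ℕ} (G : SimpleGraph (Fin n)) (i : Fin n) : Set (Fin n × Fin n) :=
  {e | G.Adj e.1 e.2 ∧ e.1 < e.2 ∧ i < e.2}

/-- `α` is a valid partial page assignment of `E_i`: no two edges of `E_i`
assigned to the same page cross. -/
def ValidOn {n k : ℕ} (G : SimpleGraph (Fin n)) (i : Fin n)
    (α : Fin n × Fin n → Fin k) : Prop :=
  ∀ e ∈ Ei G i, ∀ f ∈ Ei G i, α e = α f →
    ¬(e.1 < f.1 ∧ f.1 < e.2 ∧ e.2 < f.2)

/-- `v x` is `α`-visible to `v a` on page `p`: the chord `v x – v a` crosses no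
edge of `E_i` mapped to page `p` by `α`. -/
def VisibleOn {n k : ℕ} (G : SimpleGraph (Fin n)) (i : Fin n)
    (α : Fin n × Fin n → Fin k) (x a : Fin n) (p : Fin k) : Prop :=
  ∀ e ∈ Ei G i, α e = p →
    ¬((x < e.1 ∧ e.1 < a ∧ a < e.2) ∨ (e.1 < x ∧ x < e.2 ∧ e.2 < a))

/-- If no edge of `E_i` on page `p` has left endpoint left of
`v a`, then every `v x` with `x < a` is visible to `v a` on page `p`.
Otherwise, if `v c` is the `(α,i,p)`-important guard of `v a` (the largest
`c < a` such that some edge `(c,d) ∈ E_i` has page `p`), then `v x` (`x < a`)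
is visible to `v a` on page `p` iff `x ≥ c`. -/
theorem important_guard_visibility
    {n k : ℕ} (G : SimpleGraph (Fin n)) (i : Fin n)
    (α : Fin n × Fin n → Fin k) (hα : ValidOn G i α)
    (a : Fin n) (ha : a ≤ i) (p : Fin k) :
    ((¬ ∃ e ∈ Ei G i, e.1 < a ∧ α e = p) →
        ∀ x : Fin n, x < a → VisibleOn G i α x a p) ∧
    (∀ c : Fin n, c < a →
        (∃ d : Fin n, (c, d) ∈ Ei G i ∧ α (c, d) = p) →
        (∀ c' : Fin n, c' < a →
          (∃ d : Fin n, (c', d) ∈ Ei G i ∧ α (c', d) = p) → c' ≤ c) →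
        ∀ x : Fin n, x < a → (VisibleOn G i α x a p ↔ c ≤ x)) := by
  refine ⟨fun h x _ e he hp => ?_, fun c hca ⟨d, hd, hdp⟩ hmax x _ => ⟨fun hv => ?_, ?_⟩⟩
  · rintro (⟨-, hea, -⟩ | ⟨-, -, hea⟩)
    · exact h ⟨e, he, hea, hp⟩
    · exact (ha.trans_lt he.2.2).not_gt hea
  · by_contra! hxc
    exact hv (c, d) hd hdp (Or.inl ⟨hxc, hca, ha.trans_lt hd.2.2⟩)
  · rintro hcx e he hp (⟨hxe, hea, -⟩ | ⟨-, -, hea⟩)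
    · exact ((hmax e.1 hea ⟨e.2, he, hp⟩).trans hcx).not_gt hxe
    · exact (ha.trans_lt he.2.2).not_gt hea
end

section
/- Fix a graph G = (V,E) with vertices indexed v_1 ≺ … ≺ v_n, an index i ∈ [n], a valid partial page assignment α : E_i → {1,…,k}, and a page p. Suppose v_{i-1} is not a guard of v_i, i.e., there is no edge v_{i-1} v_q ∈ E with q ≥ i. Then for every b < i-1, the vertex v_b is α-visible to v_{i-1} on page p if and only if v_b is α-visible to v_i on page p. -/
/-- Let `j` be the immediate predecessor of `i` (`j = i - 1`).
If `v j` is not a guard of `v i` (there is no edge `v j – v q` with `q ≥ i`),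
then for every `b < j` and every page `p`, `v b` is `α`-visible to `v j` on
page `p` iff `v b` is `α`-visible to `v i` on page `p`. -/
theorem visibility_transfer_nonguard
    {n k : ℕ} (G : SimpleGraph (Fin n)) (i j : Fin n)
    (hij : (j : ℕ) + 1 = (i : ℕ))
    (α : Fin n × Fin n → Fin k) (hα : ValidOn G i α) (p : Fin k)
    (hnotguard : ¬ ∃ q : Fin n, i ≤ q ∧ G.Adj j q) :
    ∀ b : Fin n, b < j →
      (VisibleOn G i α b j p ↔ VisibleOn G i α b i p) := by
  intro b _
  refine forall₂_congr fun e he => imp_congr_right fun _ => not_congr ?_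
  obtain ⟨hadj, -, hlt⟩ := he
  have hne : (e.1 : ℕ) ≠ j := fun h =>
    hnotguard ⟨e.2, hlt.le, Fin.ext h ▸ hadj⟩
  simp only [Fin.lt_def] at *
  omega
end

section
/- Fix a graph G = (V,E) with vertices indexed v_1 ≺ … ≺ v_n, an index i ∈ [n], and a valid partial page assignment α : E_i → {1,…,k}. Let a < i be such that v_a is not a guard of v_i, and let b be the smallest index with a < b ≤ i such that either v_b is a guard of v_i or b = i (i.e., v_b is the first vertex of P_i ∪ {v_i} to the right of v_a). Then for every page p and every x < a, the vertex v_x is α-visible to v_a on page p if and only if v_x is α-visible to v_b on page p. -/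
/-- `v j` is a guard of `v i`: `j < i` and there is an edge `v j – v q` with `q ≥ i`. -/
def IsGuard {n : ℕ} (G : SimpleGraph (Fin n)) (i j : Fin n) : Prop :=
  j < i ∧ ∃ q : Fin n, i ≤ q ∧ G.Adj j q

/-- Let `a < i` with `v a` not a guard of `v i`, and let `v b`
be the first vertex of `P_i ∪ {v i}` strictly to the right of `v a`. Then for
every page `p` and every `x < a`, `v x` is `α`-visible to `v a` on page `p`
iff `v x` is `α`-visible to `v b` on page `p`. -/
theorem visibility_equals_next_guard
    {n k : ℕ} (G : SimpleGraph (Fin n)) (i : Fin n)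
    (α : Fin n × Fin n → Fin k) (hα : ValidOn G i α)
    (a b : Fin n) (hai : a < i) (hnotguard : ¬ IsGuard G i a)
    (hab : a < b) (hbi : b ≤ i) (hbg : IsGuard G i b ∨ b = i)
    (hbmin : ∀ b' : Fin n, a < b' → b' ≤ i → (IsGuard G i b' ∨ b' = i) → b ≤ b') :
    ∀ (p : Fin k) (x : Fin n), x < a →
      (VisibleOn G i α x a p ↔ VisibleOn G i α x b p) := by
  intro p x _
  refine forall₃_congr fun e he _ => not_congr ?_
  obtain ⟨hadj, -, hie⟩ := he
  have hiff : e.1 < a ↔ e.1 < b := by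
    refine ⟨fun h => h.trans hab, fun h => ?_⟩
    have hguard : IsGuard G i e.1 := ⟨h.trans_le hbi, e.2, hie.le, hadj⟩
    rcases lt_trichotomy e.1 a with hlt | heq | hgt
    · exact hlt
    · exact absurd (heq ▸ hguard) hnotguard
    · exact absurd h (hbmin e.1 hgt hguard.1.le (Or.inl hguard)).not_gt
  have hbe : b < e.2 := hbi.trans_lt hie
  have hae : a < e.2 := hab.trans hbe
  simp only [hiff, hae, hbe, hae.not_gt, hbe.not_gt]
end

section
/- Fix a graph G = (V,E) with vertices indexed v_1 ≺ … ≺ v_n, an index i ∈ [n], and a valid partial page assignment α : E_i → {1,…,k}. Let F = E_{i-1} ∖ E_i = {v_a v_i ∈ E : a < i} be the set of edges whose right endpoint is exactly v_i, and let β : F → {1,…,k}. Then α ∪ β is a valid partial page assignment of E_{i-1} if and only if for every edge v_a v_i ∈ F, the vertex v_a is α-visible to v_i on page β(v_a v_i). -/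
/-- Let `j = i - 1`, so that `E_j ∖ E_i` is the set `F` of
edges whose right endpoint is exactly `v i`.  Given a valid partial page
assignment `α` of `E_i` and an assignment `β` of the edges of `F`, the combined
assignment `α ∪ β` (which uses `β` on edges ending at `v i` and `α` elsewhere)
is a valid partial page assignment of `E_j` iff for every edge `v a – v i ∈ F`
the vertex `v a` is `α`-visible to `v i` on page `β (a, i)`. -/
theorem extension_valid_iff_visible
    {n k : ℕ} (G : SimpleGraph (Fin n)) (i j : Fin n)
    (hij : (j : ℕ) + 1 = (i : ℕ))
    (α β : Fin n × Fin n → Fin k) (hα : ValidOn G i α) :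
    ValidOn G j (fun e => if e.2 = i then β e else α e) ↔
      ∀ a : Fin n, a < i → G.Adj a i →
        VisibleOn G i α a i (β (a, i)) := by
  constructor
  · intro hv a ha hadj e he hp
    rintro (⟨h1, h2, h3⟩ | ⟨-, -, h3⟩)
    · obtain ⟨g1, g2, g3⟩ := he
      refine hv (a, i) ⟨hadj, ha, ?_⟩ e ⟨g1, g2, ?_⟩ ?_ ⟨h1, h2, h3⟩
      · change j < i
        omega
      · omega
      · simp [g3.ne', hp]
    · exact lt_asymm he.2.2 h3
  · rintro hvis ⟨a, b⟩ ⟨e1, e2, e3⟩ ⟨c, d⟩ ⟨f1, f2, f3⟩ heq ⟨h1, h2, h3⟩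
    dsimp only at *
    have hd : i < d := by omega
    rw [if_neg hd.ne'] at heq
    by_cases hb : b = i
    · subst hb
      rw [if_pos rfl] at heq
      exact hvis a e2 e1 (c, d) ⟨f1, f2, hd⟩ heq.symm (Or.inl ⟨h1, h2, h3⟩)
    · rw [if_neg hb] at heq
      have hib : i < b := by omega
      exact hα (a, b) ⟨e1, e2, hib⟩ (c, d) ⟨f1, f2, hd⟩ heq ⟨h1, h2, h3⟩
end

section
/- Fix a graph G = (V,E) with vertices indexed v_1 ≺ … ≺ v_n and an index i ∈ [n]. Let α and α' be valid partial page assignments of E_i into {1,…,k} such that for every page p, every vertex w ∈ P_i ∪ {v_i}, and every x smaller than the index of w: v_x is α-visible to w on page p if and only if v_x is α'-visible to w on page p. Let F = E_{i-1} ∖ E_i = {v_a v_i ∈ E : a < i} and let β : F → {1,…,k}. Then (1) α ∪ β is a valid partial page assignment of E_{i-1} if and only if α' ∪ β is; and (2) if both are valid, then for every page p, every vertex w ∈ P_{i-1} ∪ {v_{i-1}}, and every x smaller than the index of w: v_x is (α ∪ β)-visible to w on page p if and only if v_x is (α' ∪ β)-visible to w on page p. -/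
/-- For `w ≤ i`, if visibility under `α'` implies visibility under `α` at the guards of `i` and
at `i` itself, then it does so at `w`. -/
theorem VisibleOn.of_guards {n k : ℕ} {G : SimpleGraph (Fin n)} {i : Fin n}
    {α α' : Fin n × Fin n → Fin k} {p : Fin k} {x w : Fin n}
    (hvis : ∀ y : Fin n, (IsGuard G i y ∨ y = i) → x < y →
      VisibleOn G i α' x y p → VisibleOn G i α x y p)
    (hwi : w ≤ i) (hxw : x < w) (h : VisibleOn G i α' x w p) : VisibleOn G i α x w p := by
  obtain ⟨y, ⟨hwy, hy⟩, hmin⟩ := WellFounded.has_min (wellFounded_lt (α := Fin n))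
    {y | w ≤ y ∧ (IsGuard G i y ∨ y = i)} ⟨i, hwi, Or.inr rfl⟩
  have hyi : y ≤ i := hy.elim (fun hg => hg.1.le) le_of_eq
  have hxy : VisibleOn G i α' x y p := by
    rintro e he hep (⟨h1, h2, h3⟩ | ⟨h1, h2, h3⟩)
    · rcases lt_or_ge e.1 w with hw | hw
      · exact h e he hep (Or.inl ⟨h1, hw, hwy.trans_lt h3⟩)
      · exact hmin e.1 ⟨hw, Or.inl ⟨h2.trans_le hyi, e.2, he.2.2.le, he.1⟩⟩ h2
    · exact absurd (h3.trans_le hyi) he.2.2.not_gt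
  rintro e he hep (⟨h1, h2, h3⟩ | ⟨h1, h2, h3⟩)
  · exact hvis y hy (hxw.trans_le hwy) hxy e he hep
      (Or.inl ⟨h1, h2.trans_le hwy, hyi.trans_lt he.2.2⟩)
  · exact absurd (h3.trans_le hwi) he.2.2.not_gt

theorem mem_Ei_of_succ {n : ℕ} {G : SimpleGraph (Fin n)} {i j : Fin n}
    (hij : (j : ℕ) + 1 = (i : ℕ)) {e : Fin n × Fin n} (he : e ∈ Ei G j) (hne : e.2 ≠ i) :
    e ∈ Ei G i :=
  ⟨he.1, he.2.1, by have := he.2.2; omega⟩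

theorem Ei_subset_of_succ {n : ℕ} {G : SimpleGraph (Fin n)} {i j : Fin n}
    (hij : (j : ℕ) + 1 = (i : ℕ)) {e : Fin n × Fin n} (he : e ∈ Ei G i) : e ∈ Ei G j :=
  ⟨he.1, he.2.1, by have := he.2.2; omega⟩

theorem ValidOn.extend_of_visible {n k : ℕ} {G : SimpleGraph (Fin n)} {i j : Fin n}
    (hij : (j : ℕ) + 1 = (i : ℕ)) {α α' β : Fin n × Fin n → Fin k} (hα' : ValidOn G i α')
    (hvis : ∀ (p : Fin k) (x : Fin n), x < i →
      VisibleOn G i α x i p → VisibleOn G i α' x i p)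
    (h : ValidOn G j (fun e => if e.2 = i then β e else α e)) :
    ValidOn G j (fun e => if e.2 = i then β e else α' e) := by
  rintro e he f hf hef ⟨h1, h2, h3⟩
  have hfi : f.2 ≠ i := by
    intro hfi
    have := he.2.2
    omega
  have hf' := mem_Ei_of_succ hij hf hfi
  by_cases hei : e.2 = i
  · simp only [hei, hfi, if_true, if_false] at hef
    refine hvis (β e) e.1 (hei ▸ he.2.1) ?_ f hf' hef.symm
      (Or.inl ⟨h1, hei ▸ h2, hei ▸ h3⟩)
    rintro g hg hgp (⟨g1, g2, g3⟩ | ⟨g1, g2, g3⟩)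
    · refine h e he g (Ei_subset_of_succ hij hg) ?_
        ⟨g1, hei.symm ▸ g2, hei.symm ▸ g3⟩
      simp only [hei, g3.ne', if_true, if_false, hgp]
    · exact g3.not_gt hg.2.2
  · simp only [hei, hfi, if_false] at hef
    exact hα' e (mem_Ei_of_succ hij he hei) f hf' hef ⟨h1, h2, h3⟩

theorem VisibleOn.extend_of_imp {n k : ℕ} {G : SimpleGraph (Fin n)} {i j : Fin n}
    (hij : (j : ℕ) + 1 = (i : ℕ)) {α α' β : Fin n × Fin n → Fin k} {p : Fin k} {x w : Fin n}
    (hvis : VisibleOn G i α x w p → VisibleOn G i α' x w p)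
    (h : VisibleOn G j (fun e => if e.2 = i then β e else α e) x w p) :
    VisibleOn G j (fun e => if e.2 = i then β e else α' e) x w p := by
  intro e he hep
  by_cases hei : e.2 = i
  · simp only [hei, if_true] at hep
    exact h e he (by simp only [hei, if_true, hep])
  · simp only [hei, if_false] at hep
    refine hvis (fun g hg hgp => h g (Ei_subset_of_succ hij hg) ?_) e
      (mem_Ei_of_succ hij he hei) hep
    simp only [hg.2.2.ne', if_false, hgp]

/-- Let `j = i - 1`, so `E_j ∖ E_i` is the set of edges with
right endpoint exactly `v i`. Suppose `α, α'` are valid partial page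
assignments of `E_i` inducing identical visibilities at every vertex of
`P_i ∪ {v i}`.  Then for any assignment `β` of the new edges:
(1) `α ∪ β` is a valid partial page assignment of `E_j` iff `α' ∪ β` is; and
(2) if both are valid, they induce identical visibilities at every vertex of
`P_j ∪ {v j}`. -/
theorem interchangeable_assignments
    {n k : ℕ} (G : SimpleGraph (Fin n)) (i j : Fin n)
    (hij : (j : ℕ) + 1 = (i : ℕ))
    (α α' β : Fin n × Fin n → Fin k)
    (hα : ValidOn G i α) (hα' : ValidOn G i α')
    (hvis : ∀ (p : Fin k) (w : Fin n), (IsGuard G i w ∨ w = i) →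
      ∀ x : Fin n, x < w →
        (VisibleOn G i α x w p ↔ VisibleOn G i α' x w p)) :
    (ValidOn G j (fun e => if e.2 = i then β e else α e) ↔
      ValidOn G j (fun e => if e.2 = i then β e else α' e)) ∧
    (ValidOn G j (fun e => if e.2 = i then β e else α e) →
      ValidOn G j (fun e => if e.2 = i then β e else α' e) →
      ∀ (p : Fin k) (w : Fin n), (IsGuard G j w ∨ w = j) →
        ∀ x : Fin n, x < w →
          (VisibleOn G j (fun e => if e.2 = i then β e else α e) x w p ↔
           VisibleOn G j (fun e => if e.2 = i then β e else α' e) x w p)) := by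
  refine ⟨⟨ValidOn.extend_of_visible hij hα' fun p x hx => (hvis p i (Or.inr rfl) x hx).1,
    ValidOn.extend_of_visible hij hα fun p x hx => (hvis p i (Or.inr rfl) x hx).2⟩, ?_⟩
  intro _ _ p w hw x hxw
  have hwi : w ≤ i := by
    rcases hw with hw | rfl
    · have := hw.1
      omega
    · omega
  exact ⟨VisibleOn.extend_of_imp hij
      (VisibleOn.of_guards (fun y hy hxy => (hvis p y hy x hxy).1) hwi hxw),
    VisibleOn.extend_of_imp hij
      (VisibleOn.of_guards (fun y hy hxy => (hvis p y hy x hxy).2) hwi hxw)⟩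
end

section
/- Fix a graph G = (V,E), a vertex cover C of G with U = V ∖ C, a linear order ≺ of V in which the vertices of U are indexed u_1 ≺ … ≺ u_m, and a crossing-free page assignment s of the edges with both endpoints in C into {1,…,k}. Fix i with 2 ≤ i ≤ m, and let α and α' be valid partial page assignments (with respect to s) of E_{i-1} such that for every c ∈ C and every page p: c is (α,s)-visible to u_{i-1} on page p if and only if c is (α',s)-visible to u_{i-1} on page p. Let β assign the edges of G incident to u_{i-1} (whose other endpoints all lie in C) to pages in {1,…,k}. Then (1) α ∪ β is a valid partial page assignment of E_i if and only if α' ∪ β is; and (2) for every t ∈ [m], c ∈ C, and page p, if c is (α,s)-visible to u_t on page p exactly when c is (α',s)-visible to u_t on page p, then c is (α∪β,s)-visible to u_t on page p exactly when c is (α'∪β,s)-visible to u_t on page p. -/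
/-- Two chords with endpoint pairs `{a,b}` and `{c,d}` cross: after sorting
each pair, the pairs interleave. -/
def ChordsCross {V : Type*} [LinearOrder V] (a b c d : V) : Prop :=
  (min a b < min c d ∧ min c d < max a b ∧ max a b < max c d) ∨
  (min c d < min a b ∧ min a b < max c d ∧ max c d < max a b)

/-- `s` is a crossing-free page assignment of the edges with both endpoints
in the vertex cover `C`. -/
def CoverAssignmentValid {V : Type*} [LinearOrder V] (G : SimpleGraph V)
    (C : Set V) {k : ℕ} (s : Sym2 V → Fin k) : Prop :=
  ∀ a ∈ C, ∀ b ∈ C, ∀ c ∈ C, ∀ d ∈ C, G.Adj a b → G.Adj c d →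
    s s(a, b) = s s(c, d) → ¬ ChordsCross a b c d

/-- `α` is a valid partial page assignment (w.r.t. `s`) of
`E_t = {u_r c ∈ E : r < t, c ∈ C}` : the combined assignment `α ∪ s` is
crossing-free. -/
def ValidPartial {V : Type*} [LinearOrder V] (G : SimpleGraph V) (C : Set V)
    {k m : ℕ} (u : Fin m → V) (t : ℕ) (s α : Sym2 V → Fin k) : Prop :=
  (∀ (r r' : Fin m), (r : ℕ) < t → (r' : ℕ) < t → ∀ c ∈ C, ∀ c' ∈ C,
      G.Adj (u r) c → G.Adj (u r') c' → α s(u r, c) = α s(u r', c') →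
      ¬ ChordsCross (u r) c (u r') c') ∧
  (∀ (r : Fin m), (r : ℕ) < t → ∀ c ∈ C, G.Adj (u r) c →
      ∀ a ∈ C, ∀ b ∈ C, G.Adj a b → α s(u r, c) = s s(a, b) →
      ¬ ChordsCross (u r) c a b)

/-- `c ∈ C` is `(α,s)`-visible to `u_t'` on page `p` (w.r.t. `E_t`): the chord
`u_t' – c` crosses no edge mapped to page `p` by `α ∪ s`. -/
def VisCover {V : Type*} [LinearOrder V] (G : SimpleGraph V) (C : Set V)
    {k m : ℕ} (u : Fin m → V) (t : ℕ) (s α : Sym2 V → Fin k)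
    (t' : Fin m) (c : V) (p : Fin k) : Prop :=
  (∀ (r : Fin m), (r : ℕ) < t → ∀ d ∈ C, G.Adj (u r) d → α s(u r, d) = p →
      ¬ ChordsCross (u t') c (u r) d) ∧
  (∀ a ∈ C, ∀ b ∈ C, G.Adj a b → s s(a, b) = p → ¬ ChordsCross (u t') c a b)

theorem chordsCross_comm {V : Type*} [LinearOrder V] (a b c d : V) :
    ChordsCross a b c d ↔ ChordsCross c d a b :=
  or_comm

section

variable {V : Type*} [LinearOrder V] {G : SimpleGraph V} {C : Set V} {k m : ℕ}
  {u : Fin m → V} {s : Sym2 V → Fin k}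

/-- Visibility only depends on the values of the assignment on the edges of `E_t`. -/
theorem visCover_congr {t : ℕ} {α γ : Sym2 V → Fin k}
    (h : ∀ r : Fin m, (r : ℕ) < t → ∀ c ∈ C, γ s(u r, c) = α s(u r, c))
    (t' : Fin m) (c : V) (p : Fin k) :
    VisCover G C u t s γ t' c p ↔ VisCover G C u t s α t' c p := by
  refine and_congr_left fun _ => forall₄_congr fun r hr d hd => ?_
  rw [h r hr d hd]

/-- Validity only depends on the values of the assignment on the edges of `E_t`. -/
theorem validPartial_congr {t : ℕ} {α γ : Sym2 V → Fin k}
    (h : ∀ r : Fin m, (r : ℕ) < t → ∀ c ∈ C, γ s(u r, c) = α s(u r, c)) :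
    ValidPartial G C u t s γ ↔ ValidPartial G C u t s α := by
  refine and_congr ?_ (forall₄_congr fun r hr c hc => by rw [h r hr c hc])
  refine forall₄_congr fun r r' hr hr' => forall₄_congr fun c hc c' hc' => ?_
  rw [h r hr c hc, h r' hr' c' hc']

/-- Visibility with respect to one more vertex: no edge of the new vertex may be crossed. -/
theorem visCover_succ (j : Fin m) (γ : Sym2 V → Fin k) (t : Fin m) (c : V) (p : Fin k) :
    VisCover G C u ((j : ℕ) + 1) s γ t c p ↔
      VisCover G C u j s γ t c p ∧
        ∀ d ∈ C, G.Adj (u j) d → γ s(u j, d) = p → ¬ ChordsCross (u t) c (u j) d := by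
  constructor
  · rintro ⟨h₁, h₂⟩
    exact ⟨⟨fun r hr => h₁ r (by omega), h₂⟩, h₁ j (by omega)⟩
  · rintro ⟨⟨h₁, h₂⟩, h₃⟩
    refine ⟨fun r hr => ?_, h₂⟩
    rcases Nat.lt_succ_iff_lt_or_eq.mp hr with hr | hr
    · exact h₁ r hr
    · obtain rfl := Fin.ext hr
      exact h₃

/-- Validity with respect to one more vertex: its edges must be visible on their pages and
must not cross one another. -/
theorem validPartial_succ (j : Fin m) (γ : Sym2 V → Fin k) :
    ValidPartial G C u ((j : ℕ) + 1) s γ ↔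
      ValidPartial G C u j s γ ∧
        (∀ c ∈ C, G.Adj (u j) c → VisCover G C u j s γ j c (γ s(u j, c))) ∧
        ∀ c ∈ C, ∀ d ∈ C, G.Adj (u j) c → G.Adj (u j) d → γ s(u j, c) = γ s(u j, d) →
          ¬ ChordsCross (u j) c (u j) d := by
  constructor
  · rintro ⟨h₁, h₂⟩
    refine ⟨⟨fun r r' hr hr' => h₁ r r' (by omega) (by omega), fun r hr => h₂ r (by omega)⟩,
      fun c hc hjc => ⟨fun r hr d hd hrd he => ?_, fun a ha b hb hab he => ?_⟩,
      h₁ j j (by omega) (by omega)⟩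
    · exact h₁ j r (by omega) (by omega) c hc d hd hjc hrd he.symm
    · exact h₂ j (by omega) c hc hjc a ha b hb hab he.symm
  · rintro ⟨⟨h₁, h₂⟩, hv, h₃⟩
    refine ⟨fun r r' hr hr' c hc d hd hrc hrd he => ?_, fun r hr c hc hrc a ha b hb hab he => ?_⟩
    · rcases Nat.lt_succ_iff_lt_or_eq.mp hr with hr | hr <;>
        rcases Nat.lt_succ_iff_lt_or_eq.mp hr' with hr' | hr'
      · exact h₁ r r' hr hr' c hc d hd hrc hrd he
      · obtain rfl := Fin.ext hr'
        rw [chordsCross_comm]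
        exact (hv d hd hrd).1 r hr c hc hrc he
      · obtain rfl := Fin.ext hr
        exact (hv c hc hrc).1 r' hr' d hd hrd he.symm
      · obtain rfl := Fin.ext hr
        obtain rfl := Fin.ext hr'
        exact h₃ c hc d hd hrc hrd he
    · rcases Nat.lt_succ_iff_lt_or_eq.mp hr with hr | hr
      · exact h₂ r hr c hc hrc a ha b hb hab he
      · obtain rfl := Fin.ext hr
        exact (hv c hc hrc).2 a ha b hb hab he.symm

end

/-- `C` is a vertex cover of `G`, the vertices of
`U = V ∖ C` are enumerated in increasing `≺`-order by `u : Fin m → V`, and `s`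
is a crossing-free page assignment of the `C`–`C` edges.  In 1-based notation
fix `2 ≤ i ≤ m`; here `j : Fin m` is the (0-based) index of `u_{i-1}` and
`i : Fin m` satisfies `↑j + 1 = ↑i`, so that `E_{i-1}` has bound `↑j` and
`E_i` has bound `↑i`.  If `α, α'` are valid partial page assignments of
`E_{i-1}` giving `u_{i-1}` identical visibilities, and `β` assigns the edges
incident to `u_{i-1}` (combined as: edges containing `u j` use `β`, others
use `α`), then (1) `α ∪ β` is a valid partial page assignment of `E_i` iff
`α' ∪ β` is, and (2) for every `t`, `c ∈ C` and page `p`, if `α` and `α'` give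
`u_t` the same visibility of `c` on `p`, so do `α ∪ β` and `α' ∪ β`. -/
theorem interchangeable_cover_assignments
    {V : Type*} [LinearOrder V] (G : SimpleGraph V) (C : Set V)
    (hC : ∀ ⦃a b : V⦄, G.Adj a b → a ∈ C ∨ b ∈ C)
    {k m : ℕ} (u : Fin m → V) (hu : StrictMono u)
    (hrange : Set.range u = Cᶜ)
    (s : Sym2 V → Fin k) (hs : CoverAssignmentValid G C s)
    (i j : Fin m) (hij : (j : ℕ) + 1 = (i : ℕ))
    (α α' : Sym2 V → Fin k)
    (hα : ValidPartial G C u (j : ℕ) s α)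
    (hα' : ValidPartial G C u (j : ℕ) s α')
    (hvis : ∀ c ∈ C, ∀ p : Fin k,
      VisCover G C u (j : ℕ) s α j c p ↔ VisCover G C u (j : ℕ) s α' j c p)
    (β : Sym2 V → Fin k) :
    (ValidPartial G C u (i : ℕ) s (fun e => if u j ∈ e then β e else α e) ↔
      ValidPartial G C u (i : ℕ) s (fun e => if u j ∈ e then β e else α' e)) ∧
    (∀ (t : Fin m), ∀ c ∈ C, ∀ p : Fin k,
      (VisCover G C u (j : ℕ) s α t c p ↔ VisCover G C u (j : ℕ) s α' t c p) →
      (VisCover G C u (i : ℕ) s (fun e => if u j ∈ e then β e else α e) t c p ↔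
       VisCover G C u (i : ℕ) s (fun e => if u j ∈ e then β e else α' e) t c p)) := by
  have hagree (δ : Sym2 V → Fin k) (r : Fin m) (hr : (r : ℕ) < j) (c : V) (hc : c ∈ C) :
      (fun e => if u j ∈ e then β e else δ e) s(u r, c) = δ s(u r, c) := by
    have hj : u j ∉ C := by
      have : u j ∈ Cᶜ := hrange ▸ Set.mem_range_self j
      exact this
    have hne : u j ≠ u r := (hu hr).ne'
    have hne' : u j ≠ c := fun h => hj (h ▸ hc)
    simp [hne, hne']
  have hnew (δ : Sym2 V → Fin k) (c : V) :
      (fun e => if u j ∈ e then β e else δ e) s(u j, c) = β s(u j, c) := by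
    simp
  have hval (δ : Sym2 V → Fin k) :
      ValidPartial G C u j s (fun e => if u j ∈ e then β e else δ e) ↔
        ValidPartial G C u j s δ :=
    validPartial_congr (hagree δ)
  have hvisCover (δ : Sym2 V → Fin k) (t : Fin m) (c : V) (p : Fin k) :
      VisCover G C u j s (fun e => if u j ∈ e then β e else δ e) t c p ↔
        VisCover G C u j s δ t c p :=
    visCover_congr (hagree δ) t c p
  rw [← hij]
  refine ⟨?_, fun t c hc p h => ?_⟩
  · rw [validPartial_succ, validPartial_succ, hval, hval]
    simp only [hnew, hvisCover]
    refine and_congr (iff_of_true hα hα') (and_congr_left fun _ => ?_)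
    exact forall₃_congr fun c hc _ => hvis c hc _
  · rw [visCover_succ, visCover_succ, hvisCover, hvisCover]
    simp only [hnew, h]
end

section
/- Let G = (V,E) be a graph with a vertex cover C of size τ, let k be a positive integer, let U ⊆ C, and let V_U be the set of vertices of type U. If v ∈ V_U and |V_U| ≥ 2·k^τ + 2, then G admits a k-page book embedding if and only if the graph G − v obtained by deleting v admits a k-page book embedding. -/
/-- `G` admits a `k`-page book embedding: there is a strict total (linear)
order `lt` of the vertices and a page assignment `σ` of the edges such that no
two edges `a b`, `c d` on the same page cross (`a ≺ c ≺ b ≺ d`). -/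
def HasBookEmbedding {W : Type*} (G : SimpleGraph W) (k : ℕ) : Prop :=
  ∃ lt : W → W → Prop, IsStrictTotalOrder W lt ∧
    ∃ σ : G.edgeSet → Fin k,
      ∀ (a b c d : W) (h1 : G.Adj a b) (h2 : G.Adj c d),
        σ ⟨s(a, b), h1⟩ = σ ⟨s(c, d), h2⟩ →
        ¬(lt a c ∧ lt c b ∧ lt b d)

/-- A book embedding pulls back along an injective graph homomorphism. -/
theorem HasBookEmbedding.comap {V W : Type*} {G : SimpleGraph V} {H : SimpleGraph W} {k : ℕ}
    (h : HasBookEmbedding G k) (φ : H →g G) (hφ : Function.Injective φ) :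
    HasBookEmbedding H k := by
  obtain ⟨lt, hlt, σ, hσ⟩ := h
  refine ⟨fun a b => lt (φ a) (φ b), ?_, fun e => σ (φ.mapEdgeSet e), ?_⟩
  · exact (⟨⟨φ, hφ⟩, Iff.rfl⟩ : (fun a b => lt (φ a) (φ b)) ↪r lt).isStrictTotalOrder
  · intro a b c d h1 h2 he
    exact hσ _ _ _ _ (φ.map_adj h1) (φ.map_adj h2) he

/-- A book embedding may be given by natural-number positions on the spine. -/
theorem HasBookEmbedding.of_position {V : Type*} {G : SimpleGraph V} {k : ℕ}
    (f : V → ℕ) (hf : Function.Injective f) (σ : Sym2 V → Fin k)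
    (hσ : ∀ a b c d, G.Adj a b → G.Adj c d → σ s(a, b) = σ s(c, d) →
      ¬(f a < f c ∧ f c < f b ∧ f b < f d)) :
    HasBookEmbedding G k := by
  refine ⟨fun a b => f a < f b, ?_, fun e => σ e, fun a b c d h1 h2 => hσ a b c d h1 h2⟩
  exact (⟨⟨f, hf⟩, Iff.rfl⟩ : (fun a b => f a < f b) ↪r ((· < ·) : ℕ → ℕ → Prop)).isStrictTotalOrder

/-- A book embedding of an induced subgraph, with positions and pages extended to the whole
vertex type. -/
theorem HasBookEmbedding.exists_position_induce {V : Type*} [Finite V] {G : SimpleGraph V}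
    {s : Set V} {k : ℕ} (hk : 0 < k) (h : HasBookEmbedding (G.induce s) k) :
    ∃ (f : V → ℕ) (σ : Sym2 V → Fin k), Set.InjOn f s ∧
      ∀ a ∈ s, ∀ b ∈ s, ∀ c ∈ s, ∀ d ∈ s, G.Adj a b → G.Adj c d → σ s(a, b) = σ s(c, d) →
        ¬(f a < f c ∧ f c < f b ∧ f b < f d) := by
  classical
  obtain ⟨lt, hlt, σ, hσ⟩ := h
  let f : V → ℕ := fun a => {b : s | ∃ ha : a ∈ s, lt b ⟨a, ha⟩}.ncard
  have hmono : ∀ a b : s, lt a b → f a < f b := by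
    intro a b hab
    apply Set.ncard_lt_ncard _ (Set.toFinite _)
    refine ⟨fun c ⟨_, hc⟩ => ⟨b.2, hlt.trans _ _ _ hc hab⟩, fun hsub => ?_⟩
    obtain ⟨_, haa⟩ := hsub (show a ∈ _ from ⟨b.2, hab⟩)
    exact hlt.irrefl _ haa
  have hf : ∀ a b : s, f a < f b → lt a b := by
    intro a b hab
    rcases trichotomous_of lt a b with h | h | h
    · exact h
    · subst h; exact absurd hab (lt_irrefl _)
    · exact absurd (hmono _ _ h) (by omega)
  let ρ : Sym2 V → Fin k := fun e =>
    if h : ∃ e' : (G.induce s).edgeSet, Sym2.map Subtype.val e'.1 = e then σ h.choose else ⟨0, hk⟩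
  have hρ : ∀ e' : (G.induce s).edgeSet, ρ (Sym2.map Subtype.val e'.1) = σ e' := by
    intro e'
    have h : ∃ e'' : (G.induce s).edgeSet, Sym2.map Subtype.val e''.1 = Sym2.map Subtype.val e'.1 :=
      ⟨e', rfl⟩
    have he : h.choose = e' :=
      Subtype.ext (Sym2.map.injective Subtype.val_injective h.choose_spec)
    simp only [ρ, dif_pos h, he]
  refine ⟨f, ρ, ?_, ?_⟩
  · intro a ha b hb hab
    rcases trichotomous_of lt (⟨a, ha⟩ : s) ⟨b, hb⟩ with h | h | h
    · exact absurd (hmono _ _ h) (by simp [hab])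
    · exact congrArg Subtype.val h
    · exact absurd (hmono _ _ h) (by simp [hab])
  · rintro a ha b hb c hc d hd h1 h2 he ⟨hac, hcb, hbd⟩
    refine hσ ⟨a, ha⟩ ⟨b, hb⟩ ⟨c, hc⟩ ⟨d, hd⟩ h1 h2 ?_
      ⟨hf _ _ hac, hf _ _ hcb, hf _ _ hbd⟩
    rw [← hρ, ← hρ]
    exact he

/-- `K_{2,3}` does not embed in one page: some two of its six edges cross. -/
theorem exists_crossing_of_three_common_neighbors {V : Type*} {s : Set V} {f : V → ℕ}
    (hf : Set.InjOn f s) (E : V → V → Prop) (hE : ∀ a b, E a b → E b a)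
    (hs : ∀ a b, E a b → a ∈ s)
    {p q : V} (hpq : p ≠ q) {x y z : V} (hxy : x ≠ y) (hxz : x ≠ z) (hyz : y ≠ z)
    (hx : E x p ∧ E x q) (hy : E y p ∧ E y q) (hz : E z p ∧ E z q)
    (hp : ∀ a, ¬ E a a) :
    ∃ a b c d, E a b ∧ E c d ∧ f a < f c ∧ f c < f b ∧ f b < f d := by
  by_contra! hcon
  have hne : ∀ a ∈ s, ∀ b ∈ s, a ≠ b → f a ≠ f b := fun a ha b hb hab h => hab (hf ha hb h)
  -- Two common neighbors cannot lie on the same side of the chord `p q`.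
  have hside : ∀ p q a b, E a p → E a q → E b p → E b q → f p < f q → f a < f b →
      ((f p < f a ∧ f a < f q) ↔ ¬(f p < f b ∧ f b < f q)) := by
    intro p q a b hap haq hbp hbq hpq hab
    have n3 := hne a (hs _ _ hap) p (hs _ _ (hE _ _ hap)) (fun h => hp p (h ▸ hap))
    have n4 := hne a (hs _ _ haq) q (hs _ _ (hE _ _ haq)) (fun h => hp q (h ▸ haq))
    have n5 := hne b (hs _ _ hbp) p (hs _ _ (hE _ _ hbp)) (fun h => hp p (h ▸ hbp))
    have n6 := hne b (hs _ _ hbq) q (hs _ _ (hE _ _ hbq)) (fun h => hp q (h ▸ hbq))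
    have c1 := hcon a p b q hap hbq
    have c2 := hcon p a q b (hE _ _ hap) (hE _ _ hbq)
    have c3 := hcon p b a q (hE _ _ hbp) haq
    have c4 := hcon a q p b haq (hE _ _ hbp)
    omega
  wlog hlt : f p < f q generalizing p q
  · have hfpq := hne p (hs _ _ (hE _ _ hx.1)) q (hs _ _ (hE _ _ hx.2)) hpq
    exact this hpq.symm hx.symm hy.symm hz.symm (by omega)
  have hpair : ∀ a b, (E a p ∧ E a q) → (E b p ∧ E b q) → a ≠ b →
      ((f p < f a ∧ f a < f q) ↔ ¬(f p < f b ∧ f b < f q)) := by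
    intro a b ha hb hab
    rcases lt_or_gt_of_ne (hne a (hs _ _ ha.1) b (hs _ _ hb.1) hab) with h | h
    · exact hside p q a b ha.1 ha.2 hb.1 hb.2 hlt h
    · have := hside p q b a hb.1 hb.2 ha.1 ha.2 hlt h
      tauto
  have h1 := hpair x y hx hy hxy
  have h2 := hpair x z hx hz hxz
  have h3 := hpair y z hy hz hyz
  tauto

/-- If `x` and `v` have the same neighbors and the edges at `x` lie on pairwise distinct pages,
then a book embedding of `G - v` extends to `G` by placing `v` right after `x`. -/
theorem HasBookEmbedding.of_twin {V : Type*} {G : SimpleGraph V} {k : ℕ} {v x : V}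
    (hxv : x ≠ v) (hN : ∀ u, G.Adj v u ↔ G.Adj x u)
    (f : V → ℕ) (σ : Sym2 V → Fin k) (hf : Set.InjOn f {w | w ≠ v})
    (hσ : ∀ a ≠ v, ∀ b ≠ v, ∀ c ≠ v, ∀ d ≠ v, G.Adj a b → G.Adj c d →
      σ s(a, b) = σ s(c, d) → ¬(f a < f c ∧ f c < f b ∧ f b < f d))
    (hinj : ∀ p q, G.Adj x p → G.Adj x q → σ s(x, p) = σ s(x, q) → p = q) :
    HasBookEmbedding G k := by
  classical
  let r : V → V := fun w => if w = v then x else w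
  let g : V → ℕ := fun w => 2 * f (r w) + if w = v then 1 else 0
  have hrv : ∀ w, r w ≠ v := by intro w; simp only [r]; split_ifs <;> assumption
  have hr : ∀ a b, r a = r b → a ≠ b → r a = x := by
    intro a b h hab
    simp only [r] at h ⊢
    split_ifs at h ⊢ <;> simp_all
  have hrx : ∀ a, r a ≠ x → r a = a := by
    intro a h
    simp only [r] at h ⊢
    split_ifs at h ⊢ <;> simp_all
  have hadj : ∀ a b, G.Adj a b → G.Adj (r a) (r b) := by
    intro a b h
    by_cases ha : a = v
    · subst ha
      simpa [r, h.ne'] using (hN b).1 h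
    · by_cases hb : b = v
      · subst hb
        simpa [r, ha] using ((hN a).1 h.symm).symm
      · simpa [r, ha, hb] using h
  have hgle : ∀ a b, g a < g b → f (r a) < f (r b) ∨ r a = r b := by
    intro a b h
    rcases lt_trichotomy (f (r a)) (f (r b)) with h' | h' | h'
    · exact Or.inl h'
    · exact Or.inr (hf (hrv a) (hrv b) h')
    · simp only [g] at h
      split_ifs at h <;> omega
  -- Edges at `x` or its copy `v` on a common page have the same other end.
  have hstar : ∀ a b c d, G.Adj a b → G.Adj c d → σ s(r a, r b) = σ s(r c, r d) →
      a ≠ c → r a = r c → b = d := by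
    intro a b c d h1 h2 he hac hrac
    have hax := hr a c hrac hac
    have hcx : r c = x := hrac ▸ hax
    have k1 := hadj _ _ h1
    have k2 := hadj _ _ h2
    rw [hax] at k1 he
    rw [hcx] at k2 he
    have := hinj _ _ k1 k2 he
    rwa [hrx b k1.ne', hrx d k2.ne'] at this
  refine of_position g ?_ (fun e => σ (e.map r)) ?_
  · intro a b hab
    by_cases ha : a = v <;> by_cases hb : b = v <;>
      simp only [g, ha, hb, if_true, if_false] at hab
    · rw [ha, hb]
    · omega
    · omega
    · have h := hf (hrv a) (hrv b) (by omega)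
      simpa only [r, ha, hb, if_false] using h
  · rintro a b c d h1 h2 he ⟨hac, hcb, hbd⟩
    simp only [Sym2.map_mk] at he
    have nac : a ≠ c := by rintro rfl; omega
    have ncb : c ≠ b := by rintro rfl; omega
    have nbd : b ≠ d := by rintro rfl; omega
    have nad : a ≠ d := by rintro rfl; omega
    rcases hgle _ _ hac with hac | hac
    · rcases hgle _ _ hcb with hcb | hcb
      · rcases hgle _ _ hbd with hbd | hbd
        · exact hσ _ (hrv a) _ (hrv b) _ (hrv c) _ (hrv d) (hadj _ _ h1) (hadj _ _ h2) he
            ⟨hac, hcb, hbd⟩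
        · exact nac (hstar b a d c h1.symm h2.symm (by rw [Sym2.eq_swap, he, Sym2.eq_swap]) nbd hbd)
      · exact nad (hstar b a c d h1.symm h2 (by rwa [Sym2.eq_swap]) ncb.symm hcb.symm)
    · exact nbd (hstar a b c d h1 h2 he nac hac)

/-- Let `C` be a vertex cover of `G` of size `τ`, `k > 0`,
`U ⊆ C`, and let `V_U = {w ∉ C | N(w) = U}` be the vertices of type `U`.
If `v ∈ V_U` and `|V_U| ≥ 2·k^τ + 2`, then `G` has a `k`-page book embedding
iff `G - v` (the subgraph induced on `V ∖ {v}`) does. -/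
theorem kernel_vertex_deletion
    {V : Type*} [Fintype V] (G : SimpleGraph V) (C : Finset V) (τ k : ℕ)
    (hC : ∀ ⦃a b : V⦄, G.Adj a b → a ∈ C ∨ b ∈ C)
    (hτ : C.card = τ) (hk : 0 < k)
    (U : Finset V) (hU : U ⊆ C)
    (v : V) (hv : v ∉ C ∧ G.neighborSet v = ↑U)
    (hsize : 2 * k ^ τ + 2 ≤ {w : V | w ∉ C ∧ G.neighborSet w = ↑U}.ncard) :
    HasBookEmbedding G k ↔ HasBookEmbedding (G.induce {w : V | w ≠ v}) k := by
  classical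
  refine ⟨fun h => h.comap (SimpleGraph.Embedding.induce _).toHom Subtype.val_injective,
    fun h => ?_⟩
  obtain ⟨f, σ, hf, hσ⟩ := h.exists_position_induce hk
  let S : Finset V := {w : V | w ∉ C ∧ G.neighborSet w = ↑U}
  have hS : {w : V | w ∉ C ∧ G.neighborSet w = ↑U}.ncard = S.card := by
    rw [← Set.ncard_coe_finset]; simp [S]
  have hvS : v ∈ S := by simpa [S] using hv
  have hcard : (Finset.univ : Finset (U → Fin k)).card * 2 < (S.erase v).card := by
    have h1 : (Finset.univ : Finset (U → Fin k)).card = k ^ U.card := by simp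
    have h2 : k ^ U.card ≤ k ^ τ := Nat.pow_le_pow_right hk (hτ ▸ Finset.card_le_card hU)
    rw [h1, Finset.card_erase_of_mem hvS]
    omega
  obtain ⟨page, -, hpage⟩ := Finset.exists_lt_card_fiber_of_mul_lt_card_of_maps_to
    (f := fun (w : V) (u : U) => σ s(w, u.1)) (fun _ _ => Finset.mem_univ _) hcard
  obtain ⟨x, y, z, hx, hy, hz, hxy, hxz, hyz⟩ := Finset.two_lt_card_iff.1 hpage
  have hadj : ∀ w ∈ S, ∀ u, G.Adj w u ↔ u ∈ U := by
    intro w hw u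
    have := (Finset.mem_filter.1 hw).2.2
    rw [← SimpleGraph.mem_neighborSet, this, Finset.mem_coe]
  simp only [Finset.mem_filter, Finset.mem_erase] at hx hy hz
  refine HasBookEmbedding.of_twin hx.1.1
    (fun u => (hadj v hvS u).trans (hadj x hx.1.2 u).symm) f σ hf hσ ?_
  intro p q hp hq hpq
  by_contra hne
  rw [hadj x hx.1.2] at hp hq
  have hUv : ∀ u ∈ U, u ≠ v := fun u hu h => hv.1 (h ▸ hU hu)
  let E : V → V → Prop := fun a b => a ≠ v ∧ b ≠ v ∧ G.Adj a b ∧ σ s(a, b) = σ s(x, p)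
  have hE : ∀ w, (w ≠ v ∧ w ∈ S) ∧ (fun u : U => σ s(w, u.1)) = page → E w p ∧ E w q := by
    intro w hw
    have key : ∀ u (hu : u ∈ U), σ s(w, u) = σ s(x, u) := fun u hu =>
      congrFun (hw.2.trans hx.2.symm) ⟨u, hu⟩
    exact ⟨⟨hw.1.1, hUv p hp, (hadj w hw.1.2 p).2 hp, key p hp⟩,
      ⟨hw.1.1, hUv q hq, (hadj w hw.1.2 q).2 hq, (key q hq).trans hpq.symm⟩⟩
  obtain ⟨a, b, c, d, h1, h2, hcross⟩ := exists_crossing_of_three_common_neighbors hf E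
    (fun a b h => ⟨h.2.1, h.1, h.2.2.1.symm, by rw [Sym2.eq_swap]; exact h.2.2.2⟩)
    (fun a b h => h.1) hne hxy hxz hyz (hE x hx) (hE y hy) (hE z hz) (fun a h => h.2.2.1.ne rfl)
  exact hσ a h1.1 b h1.2.1 c h2.1 d h2.2.1 h1.2.2.1 h2.2.2.1 (h1.2.2.2.trans h2.2.2.2.symm) hcross
end

section
/- Let G = (V,E) be a graph with a vertex cover C of size τ and let k be a positive integer. For each U ⊆ C choose a subset W_U ⊆ V_U with |W_U| = min(|V_U|, 2·k^τ + 1), and let G* be the subgraph of G induced by C ∪ ⋃_{U ⊆ C} W_U. Then G admits a k-page book embedding if and only if G* admits a k-page book embedding. -/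
/-- No page of a book embedding contains a `K_{2,3}`. -/
theorem eq_of_three_common_neighbors {W α : Type*} [LinearOrder W] {G : SimpleGraph W}
    {σ : Sym2 W → α}
    (hσ : ∀ a b c d, G.Adj a b → G.Adj c d → σ s(a, b) = σ s(c, d) →
      a < c → c < b → ¬ b < d)
    {x y z p q : W} (hxy : x ≠ y) (hxz : x ≠ z) (hyz : y ≠ z) {i : α}
    (hp : ∀ w ∈ ({x, y, z} : Set W), G.Adj w p ∧ σ s(w, p) = i)
    (hq : ∀ w ∈ ({x, y, z} : Set W), G.Adj w q ∧ σ s(w, q) = i) : p = q := by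
  by_contra hpq
  wlog hlt : p < q generalizing p q
  · exact this hq hp (Ne.symm hpq) (lt_of_le_of_ne (not_lt.1 hlt) (Ne.symm hpq))
  -- two common neighbours on the same side of `{p, q}` give a crossing
  have key : ∀ u ∈ ({x, y, z} : Set W), ∀ v ∈ ({x, y, z} : Set W), u < v →
      (p < u ∧ u < q ∧ ¬ (p < v ∧ v < q)) ∨ (p < v ∧ v < q ∧ ¬ (p < u ∧ u < q)) := by
    intro u hu v hv huv
    have cross : ∀ a b c d, G.Adj a b → G.Adj c d → σ s(a, b) = i → σ s(c, d) = i →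
        a < c → c < b → ¬ b < d :=
      fun a b c d hab hcd h h' => hσ a b c d hab hcd (h.trans h'.symm)
    have hup := (hp u hu).1
    have huq := (hq u hu).1
    have hvp := (hp v hv).1
    have hvq := (hq v hv).1
    have sup := (hp u hu).2
    have suq := (hq u hu).2
    have svp := (hp v hv).2
    have svq := (hq v hv).2
    have h1 := cross p v u q hvp.symm huq (Sym2.eq_swap ▸ svp) suq
    have h2 := cross u p v q hup hvq sup svq
    have h3 := cross u q p v huq hvp.symm suq (Sym2.eq_swap ▸ svp)
    have h4 := cross p u q v hup.symm hvq.symm (Sym2.eq_swap ▸ sup) (Sym2.eq_swap ▸ svq)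
    have n1 := hup.ne.lt_or_gt
    have n2 := huq.ne.lt_or_gt
    have n3 := hvp.ne.lt_or_gt
    have n4 := hvq.ne.lt_or_gt
    clear cross hu hv hσ hp hq hup huq hvp hvq sup suq svp svq
    grind
  have key' : ∀ u ∈ ({x, y, z} : Set W), ∀ v ∈ ({x, y, z} : Set W), u ≠ v →
      ((p < u ∧ u < q) ↔ ¬ (p < v ∧ v < q)) := by
    intro u hu v hv huv
    rcases lt_or_gt_of_ne huv with h | h
    · have := key u hu v hv h
      tauto
    · have := key v hv u hu h
      tauto
  have h1 := key' x (by simp) y (by simp) hxy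
  have h2 := key' x (by simp) z (by simp) hxz
  have h3 := key' y (by simp) z (by simp) hyz
  tauto

theorem HasBookEmbedding.exists_linearOrder {W : Type*} {G : SimpleGraph W} {k : ℕ}
    (hk : 0 < k) (h : HasBookEmbedding G k) :
    ∃ (_ : LinearOrder W) (σ : Sym2 W → Fin k), ∀ a b c d, G.Adj a b → G.Adj c d →
      σ s(a, b) = σ s(c, d) → a < c → c < b → ¬ b < d := by
  classical
  obtain ⟨lt, hlt, σ, hσ⟩ := h
  refine ⟨linearOrderOfSTO lt, fun e => if he : e ∈ G.edgeSet then σ ⟨e, he⟩ else ⟨0, hk⟩, ?_⟩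
  intro a b c d hab hcd heq h1 h2 h3
  beta_reduce at heq
  rw [dif_pos (G.mem_edgeSet.2 hab), dif_pos (G.mem_edgeSet.2 hcd)] at heq
  exact hσ a b c d hab hcd heq ⟨h1, h2, h3⟩

/-- A book embedding pulls back along a graph homomorphism `f` that only identifies vertices
all of whose edges lie on pairwise distinct pages. -/
theorem hasBookEmbedding_of_hom {V W : Type*} [LinearOrder W] {G : SimpleGraph V}
    {H : SimpleGraph W} {k : ℕ} {σ : Sym2 W → Fin k}
    (hσ : ∀ a b c d, H.Adj a b → H.Adj c d → σ s(a, b) = σ s(c, d) →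
      a < c → c < b → ¬ b < d)
    (f : G →g H)
    (hf : ∀ x y, x ≠ y → f x = f y → ∀ p q, G.Adj x p → G.Adj y q →
      σ s(f x, f p) = σ s(f y, f q) → p = q) :
    HasBookEmbedding G k := by
  classical
  let L : LinearOrder V := LinearOrder.lift' (fun v => toLex (f v, embeddingToCardinal v))
    fun a b h => embeddingToCardinal.injective (congrArg (fun z => (ofLex z).2) h)
  have hL : ∀ a b, L.lt a b → f a < f b ∨ (a ≠ b ∧ f a = f b) := by
    intro a b h
    have hne : a ≠ b := by rintro rfl; exact lt_irrefl _ h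
    rcases (Prod.Lex.toLex_lt_toLex).1 (show toLex (f a, embeddingToCardinal a) < toLex (f b, embeddingToCardinal b) from h) with h | h
    · exact Or.inl h
    · exact Or.inr ⟨hne, h.1⟩
  refine ⟨L.lt, inferInstance, fun e => σ (Sym2.map f e.1), ?_⟩
  rintro a b c d hab hcd heq ⟨h1, h2, h3⟩
  simp only [Sym2.map_mk] at heq
  rcases hL _ _ h1 with h1' | ⟨n1, h1'⟩
  · rcases hL _ _ h2 with h2' | ⟨n2, h2'⟩
    · rcases hL _ _ h3 with h3' | ⟨n3, h3'⟩
      · exact hσ _ _ _ _ (f.map_adj hab) (f.map_adj hcd) heq h1' h2' h3'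
      · have := hf b d n3 h3' a c hab.symm hcd.symm
          (by rwa [Sym2.eq_swap, Sym2.eq_swap (a := f d)])
        exact h1'.ne (congrArg f this)
    · have := hf c b n2 h2' d a hcd hab.symm
        (by rw [Sym2.eq_swap (a := f b)]; exact heq.symm)
      subst this
      exact lt_asymm (lt_trans h1 h2) h3
  · have := hf a c n1 h1' b d hab hcd heq
    subst this
    exact lt_irrefl _ h3

/-- Among more than `2 * k ^ |C|` vertices outside `C` with a common neighbourhood inside the
vertex cover `C`, some vertex has all its edges on pairwise distinct pages. -/
theorem exists_pages_injective {W : Type*} [LinearOrder W] {H : SimpleGraph W} {k : ℕ}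
    {σ : Sym2 W → Fin k}
    (hσ : ∀ a b c d, H.Adj a b → H.Adj c d → σ s(a, b) = σ s(c, d) →
      a < c → c < b → ¬ b < d)
    (C T : Finset W) (N : Set W) (hN : N ⊆ C) (hT : ∀ t ∈ T, H.neighborSet t = N)
    (hcard : 2 * k ^ C.card < T.card) :
    ∃ u ∈ T, ∀ p q, H.Adj u p → H.Adj u q → σ s(u, p) = σ s(u, q) → p = q := by
  classical
  obtain ⟨g, -, hg⟩ := Finset.exists_lt_card_fiber_of_mul_lt_card_of_maps_to
    (s := T) (t := (Finset.univ : Finset (C → Fin k)))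
    (f := fun u c => σ s(u, c.1)) (n := 2) (fun _ _ => Finset.mem_univ _)
    (by simpa [mul_comm] using hcard)
  obtain ⟨x, y, z, hx, hy, hz, hxy, hxz, hyz⟩ := Finset.two_lt_card_iff.1 hg
  simp only [Finset.mem_filter] at hx hy hz
  refine ⟨x, hx.1, fun p q hp hq h => ?_⟩
  have hpN : p ∈ N := hT x hx.1 ▸ hp
  have hqN : q ∈ N := hT x hx.1 ▸ hq
  have aux : ∀ w ∈ ({x, y, z} : Set W), ∀ r ∈ N, H.Adj w r ∧ σ s(w, r) = σ s(x, r) := by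
    intro w hw r hr
    have hw' : w ∈ T ∧ (fun c : C => σ s(w, c.1)) = g := by
      rcases hw with rfl | rfl | rfl <;> assumption
    refine ⟨?_, congrFun (hw'.2.trans hx.2.symm) ⟨r, hN hr⟩⟩
    have := hT w hw'.1
    rwa [← this] at hr
  exact eq_of_three_common_neighbors hσ hxy hxz hyz (fun w hw => aux w hw p hpN)
    (fun w hw => h ▸ aux w hw q hqN)

/-- Let `C` be a vertex cover of `G` of size `τ` and `k > 0`.
For each `U ⊆ C`, `V_U = {w ∉ C | N(w) = U}` is the set of vertices of type
`U`; choose `W U ⊆ V_U` with `|W U| = min (|V_U|) (2·k^τ + 1)`, and let `G*`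
be the subgraph of `G` induced by `C ∪ ⋃_{U ⊆ C} W U`.  Then `G` has a
`k`-page book embedding iff `G*` does. -/
theorem kernel_graph
    {V : Type*} [Fintype V] (G : SimpleGraph V) (C : Finset V) (τ k : ℕ)
    (hC : ∀ ⦃a b : V⦄, G.Adj a b → a ∈ C ∨ b ∈ C)
    (hτ : C.card = τ) (hk : 0 < k)
    (W : Finset V → Set V)
    (hWsub : ∀ U : Finset V, U ⊆ C →
      W U ⊆ {w : V | w ∉ C ∧ G.neighborSet w = ↑U})
    (hWcard : ∀ U : Finset V, U ⊆ C →
      (W U).ncard =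
        min ({w : V | w ∉ C ∧ G.neighborSet w = ↑U}.ncard) (2 * k ^ τ + 1)) :
    HasBookEmbedding G k ↔
      HasBookEmbedding
        (G.induce (↑C ∪ ⋃ (U : Finset V) (_ : U ⊆ C), W U)) k := by
  classical
  set S : Set V := ↑C ∪ ⋃ (U : Finset V) (_ : U ⊆ C), W U
  have hCS : ∀ v ∈ C, v ∈ S := fun v hv => Or.inl hv
  constructor
  · intro h
    obtain ⟨_, σ, hσ⟩ := h.exists_linearOrder hk
    exact hasBookEmbedding_of_hom hσ (SimpleGraph.Embedding.induce S).toHom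
      fun x y hxy h => (hxy (Subtype.ext h)).elim
  intro h
  obtain ⟨_, σ, hσ⟩ := h.exists_linearOrder hk
  have hex : ∀ v : V, ∃ u : S, (∀ hv : v ∈ S, u = ⟨v, hv⟩) ∧
      (v ∉ S → u.1 ∉ C ∧ G.neighborSet u = G.neighborSet v ∧
        ∀ p q, (G.induce S).Adj u p → (G.induce S).Adj u q → σ s(u, p) = σ s(u, q) → p = q) := by
    intro v
    by_cases hv : v ∈ S
    · exact ⟨⟨v, hv⟩, fun _ => rfl, fun h => absurd hv h⟩
    have hvC : v ∉ C := fun h => hv (hCS v h)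
    obtain ⟨U, hU⟩ : ∃ U : Finset V, G.neighborSet v = ↑U :=
      ⟨(G.neighborSet v).toFinset, by simp⟩
    have hUC : U ⊆ C := by
      intro c hc
      have hc' : c ∈ G.neighborSet v := hU ▸ hc
      exact (hC hc').resolve_left hvC
    have hWS : W U ⊆ S := fun w hw => Or.inr (Set.mem_iUnion₂.2 ⟨U, hUC, hw⟩)
    have hlt : (W U).ncard < ({w : V | w ∉ C ∧ G.neighborSet w = ↑U}).ncard :=
      Set.ncard_lt_ncard ⟨hWsub U hUC, fun h => hv (hWS (h ⟨hvC, hU⟩))⟩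
    have hcard : (W U).ncard = 2 * k ^ τ + 1 := by
      have := hWcard U hUC
      omega
    have hinj := Subtype.val_injective (p := (· ∈ S))
    have hTU : ((Finset.univ.filter fun u : S => u.1 ∈ W U).map ⟨_, hinj⟩ : Finset V)
        = (W U).toFinset := by
      ext w
      simp only [Finset.mem_map, Finset.mem_filter, Finset.mem_univ, true_and,
        Function.Embedding.coeFn_mk, Set.mem_toFinset]
      exact ⟨fun ⟨a, ha, e⟩ => e ▸ ha, fun hw => ⟨⟨w, hWS hw⟩, hw, rfl⟩⟩
    obtain ⟨u, hu, hgood⟩ := exists_pages_injective hσ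
      (Finset.univ.filter fun u : S => u.1 ∈ C) (Finset.univ.filter fun u : S => u.1 ∈ W U)
      {u : S | u.1 ∈ U} (fun u hu => by simpa using hUC hu)
      (fun t ht => by
        have ht' := (hWsub U hUC (Finset.mem_filter.1 ht).2).2
        ext w
        exact Set.ext_iff.1 ht' w.1)
      (by
        have h1 : (Finset.univ.filter fun u : S => u.1 ∈ C).card ≤ τ := by
          rw [← hτ]
          exact Finset.card_le_card_of_injOn Subtype.val
            (fun a ha => (Finset.mem_filter.1 ha).2) hinj.injOn
        have h2 := Nat.pow_le_pow_right hk h1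
        have h3 := congrArg Finset.card hTU
        rw [Finset.card_map, ← Set.ncard_eq_toFinset_card', hcard] at h3
        omega)
    have huW := hWsub U hUC (Finset.mem_filter.1 hu).2
    exact ⟨u, fun h => absurd h hv, fun _ => ⟨huW.1, huW.2.trans hU.symm, hgood⟩⟩
  choose f hfS hfN using hex
  have hfC : ∀ v ∈ C, (f v).1 = v := fun v hv => by rw [hfS v (hCS v hv)]
  have hadj : ∀ a b, a ∈ C → G.Adj a b → G.Adj a (f b) := by
    intro a b ha hab
    by_cases hb : b ∈ S
    · rwa [hfS b hb]
    · have : a ∈ G.neighborSet (f b) := (hfN b hb).2.1 ▸ hab.symm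
      exact this.symm
  let F : G →g G.induce S := ⟨f, by
    intro a b hab
    change G.Adj (f a) (f b)
    rcases hC hab with ha | hb
    · rw [hfC a ha]
      exact hadj a b ha hab
    · rw [hfC b hb]
      exact (hadj b a hb hab.symm).symm⟩
  have main : ∀ x y, x ∉ S → f x = f y → ∀ p q, G.Adj x p → G.Adj y q →
      σ s(f x, f p) = σ s(f y, f q) → p = q := by
    intro x y hx hxy p q hp hq h
    have hxC : x ∉ C := fun h => hx (hCS x h)
    have hyC : y ∉ C := fun hy => (hfN x hx).1 (by rw [hxy, hfC y hy]; exact hy)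
    have hpq := (hfN x hx).2.2 (f p) (f q) (F.map_adj hp)
      (by have := F.map_adj hq; change (G.induce S).Adj (f y) (f q) at this; rwa [← hxy] at this)
      (by rw [h, hxy])
    rw [← hfC p ((hC hp).resolve_left hxC), ← hfC q ((hC hq).resolve_left hyC), hpq]
  refine hasBookEmbedding_of_hom hσ F fun x y hne hxy p q hp hq h => ?_
  by_cases hx : x ∈ S
  · by_cases hy : y ∈ S
    · refine absurd ?_ hne
      have : f x = f y := hxy
      rw [hfS x hx, hfS y hy] at this
      exact congrArg Subtype.val this
    · exact (main y x hy hxy.symm q p hq hp h.symm).symm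
  · exact main x y hx hxy p q hp hq h
end

section
/- Let G = (V,E) be a graph, let v ∈ V with neighborhood N_G(v) = U, and suppose the graph G − v admits a k-page book embedding (≺, σ). Suppose further there is a vertex u of G − v with u ∉ U whose neighborhood in G − v is exactly U and such that for each page p ∈ {1,…,k}, at most one edge incident to u is assigned to p by σ. Then G admits a k-page book embedding; indeed, the pair (≺', σ') obtained by inserting v immediately after u in ≺ and setting σ'(vw) = σ(uw) for every w ∈ U (and σ' = σ on all edges of G − v) is a k-page book embedding of G. -/
/-- The strict order obtained from `lt` by (re)inserting `v` immediately after
`u`: vertices other than `v` keep their `lt`-order, everything `≤ u` precedes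
`v`, and everything `> u` succeeds `v`. -/
def insertAfter {V : Type*} [DecidableEq V] (lt : V → V → Prop) (u v : V) :
    V → V → Prop :=
  fun a b =>
    if a = v then b ≠ v ∧ lt u b
    else if b = v then a = u ∨ lt a u
    else lt a b

/-- The page assignment obtained from `σ` by assigning each edge `v w` to the
page of the corresponding edge `u w`, and keeping `σ` on all other edges. -/
def extendAssign {V : Type*} [DecidableEq V] {k : ℕ} (σ : V → V → Fin k)
    (u v : V) : V → V → Fin k :=
  fun a b => if a = v then σ u b else if b = v then σ a u else σ a b

/-- Reinserting a vertex immediately after another one yields a strict total order. -/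
theorem isStrictTotalOrder_insertAfter {V : Type*} [DecidableEq V] {lt : V → V → Prop}
    (hlt : IsStrictTotalOrder V lt) (u v : V) :
    IsStrictTotalOrder V (insertAfter lt u v) := by
  have hirr : ∀ a, ¬ lt a a := hlt.irrefl
  have htrans : ∀ a b c, lt a b → lt b c → lt a c := hlt.trans
  have htri : ∀ a b, ¬ lt a b → ¬ lt b a → a = b := hlt.trichotomous
  exact
    { trichotomous := by
        intro a b
        unfold insertAfter
        grind
      irrefl := by
        intro a
        unfold insertAfter
        grind
      trans := by
        intro a b c
        unfold insertAfter
        grind }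

/-- Identifying `v` with `u` is monotone for the order with `v` inserted immediately after `u`,
and strictly so except on the pair `(u, v)`. -/
theorem lt_or_eq_of_insertAfter {V : Type*} [DecidableEq V] {lt : V → V → Prop} {u v : V}
    {a b : V} (h : insertAfter lt u v a b) :
    lt (if a = v then u else a) (if b = v then u else b) ∨ (a = u ∧ b = v) := by
  unfold insertAfter at h
  grind

/-- Let `v` be a vertex of `G` with neighbourhood `U`, and
let `(lt, σ)` be a `k`-page book embedding of `G - v` (here `σ` is a symmetric
page assignment and the non-crossing condition is required for all edges of
`G` avoiding `v`).  Suppose `u ≠ v` is a vertex of `G - v` with `u ∉ U` whose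
neighbourhood in `G - v` is exactly `U`, and such that on each page at most
one edge of `G - v` incident to `u` lies.  Then the pair `(lt', σ')` obtained
by inserting `v` immediately after `u` and assigning each edge `v w` (`w ∈ U`)
to the page of `u w` is a `k`-page book embedding of `G`; in particular `G`
admits a `k`-page book embedding. -/
theorem insert_twin_vertex_book_embedding
    {V : Type*} [DecidableEq V] (G : SimpleGraph V) (k : ℕ)
    (v : V) (U : Set V) (hNv : G.neighborSet v = U)
    (lt : V → V → Prop) (hlt : IsStrictTotalOrder V lt)
    (σ : V → V → Fin k) (hσsymm : ∀ a b : V, σ a b = σ b a)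
    (hbe : ∀ a b c d : V, a ≠ v → b ≠ v → c ≠ v → d ≠ v →
      G.Adj a b → G.Adj c d → σ a b = σ c d →
      ¬(lt a c ∧ lt c b ∧ lt b d))
    (u : V) (huv : u ≠ v) (huU : u ∉ U)
    (hNu : {w : V | w ≠ v ∧ G.Adj u w} = U)
    (hpage : ∀ w w' : V, w ≠ v → w' ≠ v → G.Adj u w → G.Adj u w' →
      σ u w = σ u w' → w = w') :
    IsStrictTotalOrder V (insertAfter lt u v) ∧
    (∀ a b c d : V, G.Adj a b → G.Adj c d →
      extendAssign σ u v a b = extendAssign σ u v c d →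
      ¬(insertAfter lt u v a c ∧ insertAfter lt u v c b ∧
        insertAfter lt u v b d)) := by
  have hto := isStrictTotalOrder_insertAfter hlt u v
  have hirr' : ∀ a, ¬ insertAfter lt u v a a := hto.irrefl
  have htrans' : ∀ a b c, insertAfter lt u v a b → insertAfter lt u v b c →
      insertAfter lt u v a c := hto.trans
  have hv : ∀ w, G.Adj v w ↔ w ≠ v ∧ G.Adj u w := fun w => by
    rw [← SimpleGraph.mem_neighborSet, hNv, ← hNu]; rfl
  have hnuv : ¬ G.Adj u v := fun h => huU (hNv ▸ h.symm)
  have hadj : ∀ a b, G.Adj a b → G.Adj (if a = v then u else a) (if b = v then u else b) := by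
    intro a b h
    have := h.symm
    have := h.ne
    have := fun w => G.adj_comm u w
    grind
  have hne : ∀ a, (if a = v then u else a) ≠ v := by grind
  have hσ : ∀ a b, G.Adj a b →
      extendAssign σ u v a b = σ (if a = v then u else a) (if b = v then u else b) := by
    intro a b h
    have := h.ne
    unfold extendAssign
    grind
  refine ⟨hto, ?_⟩
  rintro a b c d hab hcd hpg ⟨hac, hcb, hbd⟩
  have had := htrans' _ _ _ (htrans' _ _ _ hac hcb) hbd
  have hab' := hadj a b hab
  have hcd' := hadj c d hcd
  rw [hσ a b hab, hσ c d hcd] at hpg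
  rcases lt_or_eq_of_insertAfter hac with h₁ | ⟨rfl, rfl⟩
  · rcases lt_or_eq_of_insertAfter hcb with h₂ | ⟨rfl, rfl⟩
    · rcases lt_or_eq_of_insertAfter hbd with h₃ | ⟨rfl, rfl⟩
      · exact hbe _ _ _ _ (hne a) (hne b) (hne c) (hne d) hab' hcd' hpg ⟨h₁, h₂, h₃⟩
      · have hav : a ≠ d := fun h => hnuv (h ▸ hab.symm)
        have hcv : c ≠ d := hcd.ne
        simp only [hav, hcv, huv, if_true, if_false] at hpg hab' hcd'
        rw [hσsymm a, hσsymm c] at hpg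
        obtain rfl := hpage _ _ hav hcv hab'.symm hcd'.symm hpg
        exact hirr' _ hac
    · have hav : a ≠ b := hab.ne
      have hdv : d ≠ b := fun h => hnuv (h ▸ hcd)
      simp only [hav, hdv, huv, if_true, if_false] at hpg hab' hcd'
      rw [hσsymm a] at hpg
      obtain rfl := hpage _ _ hav hdv hab'.symm hcd' hpg
      exact hirr' _ had
  · have hbv : b ≠ c := fun h => hnuv (h ▸ hab)
    have hdv : d ≠ c := hcd.ne'
    simp only [hbv, hdv, huv, if_true, if_false] at hpg hab' hcd'
    obtain rfl := hpage _ _ hbv hdv hab' hcd' hpg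
    exact hirr' _ hbd
end
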